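/- For every Eulerian graph G of order n, the Wiener index W(G) is at most W(C_n), with equality if and only if G ≅ C_n. -/

import Mathlib

open SimpleGraph Finset

/-- Wiener index: sum of distances over unordered pairs of vertices. -/
noncomputable def wienerIndex {n : ℕ} (G : SimpleGraph (Fin n)) : ℕ :=
  ∑ p ∈ Finset.univ.filter (fun p : Fin n × Fin n => p.1 < p.2), G.dist p.1 p.2

/-- Harary index: sum of reciprocal distances over unordered pairs of vertices. -/
noncomputable def hararyIndex {n : ℕ} (G : SimpleGraph (Fin n)) : ℝ :=
  ∑ p ∈ Finset.univ.filter (fun p : Fin n × Fin n => p.1 < p.2), (1 : ℝ) / (G.dist p.1 p.2)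

/-- A graph is Eulerian if it is connected and every vertex has even degree. -/
def IsEulerian {n : ℕ} (G : SimpleGraph (Fin n)) [DecidableRel G.Adj] : Prop :=
  G.Connected ∧ ∀ v, Even (G.degree v)

/-- A graph is 2-edge-connected if it is connected and remains connected
after the deletion of any single edge. -/
def TwoEdgeConnected {n : ℕ} (G : SimpleGraph (Fin n)) : Prop :=
  G.Connected ∧ ∀ e ∈ G.edgeSet, (G.deleteEdges {e}).Connected

/-- A graph is 2-connected if it has at least 3 vertices and deleting any
single vertex leaves it connected (no cutvertex). -/
def TwoConnected {n : ℕ} (G : SimpleGraph (Fin n)) : Prop :=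
  3 ≤ n ∧ G.Connected ∧
    ∀ v : Fin n, ((⊤ : G.Subgraph).deleteVerts {v}).coe.Connected

namespace SimpleGraph

lemma four_mul_sum_le_sq_of_drop_two (N : ℕ) (a : ℕ → ℕ)
    (ha : ∀ i, 0 < a (i + 1) → a (i + 1) + 2 ≤ a i) :
    4 * ∑ i ∈ range N, a i ≤ (a 0 + 1) ^ 2 := by
  induction N generalizing a with
  | zero => simp
  | succ N ih =>
    have h := ih (fun i => a (i + 1)) fun i => ha (i + 1)
    rw [sum_range_succ', mul_add]
    rcases Nat.eq_zero_or_pos (a 1) with h1 | h1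
    · have hz : ∀ i, a (i + 1) = 0 := by
        intro i
        induction i with
        | zero => exact h1
        | succ i ih => have := ha (i + 1); grind
      simp only [hz, sum_const_zero]
      nlinarith [four_mul_le_sq_add (a 0) 1]
    · obtain ⟨k, hk⟩ := Nat.exists_eq_add_of_le (ha 0 h1)
      simp only [zero_add] at h hk
      rw [hk]
      nlinarith [Nat.zero_le k]

lemma three_mul_sum_add_le_sq (N : ℕ) (a : ℕ → ℕ)
    (h1 : ∀ i, 0 < a (i + 1) → a (i + 1) + 1 ≤ a i)
    (h2 : ∀ i, 0 < a (i + 1) → a (i + 2) + 3 ≤ a i) :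
    3 * ∑ i ∈ range N, a (i + 1) + a 0 ≤ a 0 ^ 2 := by
  have hz : a 1 = 0 → ∀ i, a (i + 1) = 0 := by
    intro h i
    induction i with
    | zero => exact h
    | succ i ih => have := h1 (i + 1); grind
  induction N using Nat.twoStepInduction generalizing a with
  | zero => simp; nlinarith
  | one =>
    simp only [sum_range_one, zero_add]
    rcases Nat.eq_zero_or_pos (a 1) with h | h
    · rw [h]; nlinarith
    · have := h1 0 h
      have := h2 0 h
      simp only [zero_add] at *
      nlinarith
  | more N ih _ =>
    have hi := ih (fun i => a (i + 2)) (fun i => h1 (i + 2)) (fun i => h2 (i + 2)) (by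
      intro h i
      induction i with
      | zero => exact h
      | succ i ih => have := h1 (i + 3); grind)
    rcases Nat.eq_zero_or_pos (a 1) with h | h
    · simp only [hz h, sum_const_zero]; nlinarith
    · have e1 := h1 0 h
      have e2 := h2 0 h
      rw [sum_range_succ', sum_range_succ']
      simp only [zero_add] at *
      obtain ⟨k, hk⟩ := Nat.exists_eq_add_of_le e2
      have : ∑ i ∈ range N, a (i + 1 + 1 + 1) = ∑ i ∈ range N, a (i + 1 + 2) := rfl
      rw [this]
      rw [hk] at e1 ⊢
      nlinarith

lemma sum_min_range (n : ℕ) : ∑ k ∈ range n, min k (n - k) = n ^ 2 / 4 := by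
  induction n using Nat.twoStepInduction with
  | zero => simp
  | one => simp
  | more n ih _ =>
    rw [sum_range_succ']
    have : ∀ k ∈ range (n + 1), min (k + 1) (n + 2 - (k + 1)) = min k (n - k) + 1 := by
      intro k hk
      have := mem_range.1 hk
      omega
    rw [sum_congr rfl this, sum_add_distrib, sum_range_succ, ih]
    simp only [sum_const, card_range, smul_eq_mul]
    have : (n + 2) ^ 2 = n ^ 2 + 4 * (n + 1) := by ring
    omega

variable {V : Type*} {G : SimpleGraph V}

/-- Every edge crossing a vertex cut is accompanied by another crossing edge. -/
def IsBridgeless (G : SimpleGraph V) : Prop :=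
  ∀ S : Set V, ∀ x ∈ S, ∀ y ∉ S, G.Adj x y →
    ∃ x' ∈ S, ∃ y' ∉ S, G.Adj x' y' ∧ (x' = x → y' ≠ y)

/-- The vertex `c` separates the nonempty set `A` from the nonempty rest of the graph. -/
structure IsCut (G : SimpleGraph V) (c : V) (A : Finset V) : Prop where
  notMem : c ∉ A
  nonempty : A.Nonempty
  exists_other : ∃ b, b ∉ A ∧ b ≠ c
  eq_of_adj : ∀ x ∈ A, ∀ y ∉ A, G.Adj x y → y = c

lemma Connected.exists_adj_dist_eq (hG : G.Connected) {v u : V} {k : ℕ}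
    (h : G.dist v u = k + 1) : ∃ w, G.Adj w u ∧ G.dist v w = k := by
  obtain ⟨p, hp⟩ := hG.exists_walk_length_eq_dist u v
  rw [dist_comm, h] at hp
  cases p with
  | nil => simp at hp
  | @cons _ w _ huw q =>
    refine ⟨w, huw.symm, ?_⟩
    have h1 := dist_le q
    have h2 := hG.dist_triangle (u := v) (v := w) (w := u)
    rw [dist_eq_one_iff_adj.2 huw.symm] at h2
    rw [Walk.length_cons] at hp
    rw [dist_comm] at h1
    omega

lemma Connected.exists_dist_eq (hG : G.Connected) {v u : V} {i : ℕ}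
    (h : i ≤ G.dist v u) : ∃ w, G.dist v w = i := by
  obtain ⟨k, hk⟩ := Nat.exists_eq_add_of_le h
  clear h
  induction k generalizing u with
  | zero => exact ⟨u, hk⟩
  | succ k ih =>
    obtain ⟨w, -, hw⟩ := hG.exists_adj_dist_eq (k := i + k) hk
    exact ih hw

lemma Connected.dist_le_dist_add_one_of_adj (hG : G.Connected) {v x y : V} (h : G.Adj x y) :
    G.dist v y ≤ G.dist v x + 1 := by
  simpa [dist_eq_one_iff_adj.2 h] using hG.dist_triangle (u := v) (v := x) (w := y)

section Layers

variable [Fintype V]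

/-- The number of vertices at distance exactly `i` from `v`. -/
noncomputable def layerCard (G : SimpleGraph V) (v : V) (i : ℕ) : ℕ :=
  #{u | G.dist v u = i}

/-- The number of vertices at distance at least `i` from `v`. -/
noncomputable def farCard (G : SimpleGraph V) (v : V) (i : ℕ) : ℕ :=
  #{u | i ≤ G.dist v u}

lemma layerCard_add_farCard (v : V) (i : ℕ) :
    G.layerCard v i + G.farCard v (i + 1) = G.farCard v i := by
  classical
  rw [layerCard, farCard, farCard, ← card_union_of_disjoint]
  · congr 1
    ext u
    simp only [mem_union, mem_filter, mem_univ, true_and]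
    omega
  · rw [disjoint_filter]
    intros
    omega

@[simp] lemma farCard_zero (v : V) : G.farCard v 0 = Fintype.card V := by
  simp [farCard, Finset.card_univ]

lemma Connected.layerCard_zero (hG : G.Connected) (v : V) : G.layerCard v 0 = 1 := by
  rw [layerCard, card_eq_one]
  refine ⟨v, ?_⟩
  ext u
  simp [hG.dist_eq_zero_iff, eq_comm]

lemma layerCard_one (v : V) : G.layerCard v 1 = (G.neighborSet v).ncard := by
  rw [layerCard, ← Set.ncard_coe_finset]
  congr 1
  ext u
  simp

lemma exists_sum_dist_eq_sum_farCard (v : V) :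
    ∃ N, ∑ u, G.dist v u = ∑ i ∈ range (N + 1), G.farCard v (i + 1) := by
  refine ⟨∑ u, G.dist v u, ?_⟩
  simp only [farCard, card_filter]
  rw [sum_comm]
  refine sum_congr rfl fun u _ => ?_
  rw [← card_filter]
  have hu : G.dist v u ≤ ∑ u, G.dist v u :=
    single_le_sum (f := fun u => G.dist v u) (fun _ _ => Nat.zero_le _) (mem_univ u)
  have : {i ∈ range (∑ u, G.dist v u + 1) | i + 1 ≤ G.dist v u} = range (G.dist v u) := by
    ext i
    simp only [mem_filter, mem_range]
    omega
  rw [this, card_range]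

lemma Connected.layerCard_pos (hG : G.Connected) {v : V} {i : ℕ} (h : 0 < G.farCard v i) :
    0 < G.layerCard v i := by
  obtain ⟨u, hu⟩ := card_pos.1 h
  obtain ⟨w, hw⟩ := hG.exists_dist_eq (mem_filter.1 hu).2
  exact card_pos.2 ⟨w, by simpa using hw⟩

lemma farCard_anti (v : V) (i : ℕ) : G.farCard v (i + 1) ≤ G.farCard v i := by
  have := layerCard_add_farCard (G := G) v i
  omega

lemma Connected.two_le_layerCard (hG : G.Connected) (hc : ∀ c A, ¬ G.IsCut c A) {v : V} {i : ℕ}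
    (h : 0 < G.farCard v (i + 2)) : 2 ≤ G.layerCard v (i + 1) := by
  by_contra! hlt
  have hpos := hG.layerCard_pos (h.trans_le (farCard_anti v (i + 1)))
  obtain ⟨c, hcL⟩ := card_eq_one.1 (show G.layerCard v (i + 1) = 1 by omega)
  have hL : ∀ u, G.dist v u = i + 1 ↔ u = c := fun u => by
    simpa using Finset.ext_iff.1 hcL u
  have hcd := (hL c).2 rfl
  obtain ⟨b, hb⟩ := card_pos.1 h
  replace hb := (mem_filter.1 hb).2
  refine hc c {u | G.dist v u ≤ i} ⟨by simp [hcd], ⟨v, by simp⟩, ⟨b, by simp; omega, ?_⟩, ?_⟩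
  · rintro rfl
    omega
  · intro x hx y hy hxy
    simp only [mem_filter, mem_univ, true_and] at hx hy
    have := hG.dist_le_dist_add_one_of_adj (v := v) hxy
    exact (hL y).1 (by omega)

lemma Connected.three_le_layerCard_add (hG : G.Connected) (hb : G.IsBridgeless) {v : V} {i : ℕ}
    (h : 0 < G.farCard v (i + 1)) : 3 ≤ G.layerCard v i + G.layerCard v (i + 1) := by
  by_contra! hlt
  have h1 := hG.layerCard_pos h
  have h0 := hG.layerCard_pos (h.trans_le (farCard_anti v i))
  obtain ⟨x, hx⟩ := card_eq_one.1 (show G.layerCard v i = 1 by omega)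
  obtain ⟨y, hy⟩ := card_eq_one.1 (show G.layerCard v (i + 1) = 1 by omega)
  have hX : ∀ u, G.dist v u = i ↔ u = x := fun u => by simpa using Finset.ext_iff.1 hx u
  have hY : ∀ u, G.dist v u = i + 1 ↔ u = y := fun u => by simpa using Finset.ext_iff.1 hy u
  obtain ⟨w, hwy, hw⟩ := hG.exists_adj_dist_eq ((hY y).2 rfl)
  obtain rfl := (hX w).1 hw
  obtain ⟨x', hx', y', hy', hadj, hne⟩ := hb {u | G.dist v u ≤ i} w hw.le y
    (by simp [(hY y).2 rfl]) hwy
  simp only [Set.mem_ofPred_eq, not_le] at hx' hy'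
  have := hG.dist_le_dist_add_one_of_adj (v := v) hadj
  exact hne ((hX x').1 (by omega)) ((hY y').1 (by omega))

lemma Connected.three_mul_sum_dist_le (hG : G.Connected) (hb : G.IsBridgeless) (v : V) :
    3 * ∑ u, G.dist v u + Fintype.card V ≤ Fintype.card V ^ 2 := by
  obtain ⟨N, hN⟩ := exists_sum_dist_eq_sum_farCard (G := G) v
  rw [hN, ← farCard_zero (G := G) v]
  apply three_mul_sum_add_le_sq
  · intro i hi
    have := layerCard_add_farCard (G := G) v i
    have := hG.layerCard_pos (hi.trans_le (farCard_anti v i))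
    omega
  · intro i hi
    have := layerCard_add_farCard (G := G) v i
    have : G.layerCard v (i + 1) + G.farCard v (i + 2) = G.farCard v (i + 1) :=
      layerCard_add_farCard v (i + 1)
    have := hG.three_le_layerCard_add hb hi
    omega

lemma Connected.farCard_add_two_le (hG : G.Connected) (hc : ∀ c A, ¬ G.IsCut c A) (v : V) (i : ℕ)
    (h : 0 < G.farCard v (i + 2)) : G.farCard v (i + 2) + 2 ≤ G.farCard v (i + 1) := by
  have : G.layerCard v (i + 1) + G.farCard v (i + 2) = G.farCard v (i + 1) :=
      layerCard_add_farCard v (i + 1)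
  have := hG.two_le_layerCard hc h
  omega

lemma Connected.four_mul_sum_dist_le (hG : G.Connected) (hc : ∀ c A, ¬ G.IsCut c A) (v : V) :
    4 * ∑ u, G.dist v u ≤ Fintype.card V ^ 2 := by
  obtain ⟨N, hN⟩ := exists_sum_dist_eq_sum_farCard (G := G) v
  have h0 := layerCard_add_farCard (G := G) v 0
  rw [hG.layerCard_zero, farCard_zero] at h0
  rw [hN, ← h0, add_comm 1]
  exact four_mul_sum_le_sq_of_drop_two (N + 1) (fun i => G.farCard v (i + 1))
    (hG.farCard_add_two_le hc v)

lemma Connected.ncard_neighborSet_eq_two (hG : G.Connected) (hc : ∀ c A, ¬ G.IsCut c A)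
    (h3 : 3 ≤ Fintype.card V) (v : V) (hv : ∑ u, G.dist v u = Fintype.card V ^ 2 / 4) :
    (G.neighborSet v).ncard = 2 := by
  obtain ⟨N, hN⟩ := exists_sum_dist_eq_sum_farCard (G := G) v
  have h0 := layerCard_add_farCard (G := G) v 0
  have h1 := layerCard_add_farCard (G := G) v 1
  rw [hG.layerCard_zero, farCard_zero] at h0
  simp only [zero_add] at h0
  have h2 := hG.farCard_add_two_le hc v 0
  have h4 := four_mul_sum_le_sq_of_drop_two N (fun i => G.farCard v (i + 2))
    (fun i => hG.farCard_add_two_le hc v (i + 1))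
  rw [sum_range_succ', hv] at hN
  rw [← layerCard_one]
  simp only [zero_add] at h2 h4 hN h1
  have e : ∑ i ∈ range N, G.farCard v (i + 1 + 1) = ∑ i ∈ range N, G.farCard v (i + 2) := rfl
  rw [e] at hN
  norm_num at h1 h2
  by_contra hne
  have h5 : G.farCard v 2 + 4 ≤ Fintype.card V := by omega
  obtain ⟨k, hk⟩ := Nat.exists_eq_add_of_le h5
  have h6 : 4 * (Fintype.card V ^ 2 / 4) + 3 ≥ Fintype.card V ^ 2 := by omega
  rcases Nat.eq_zero_or_pos (G.farCard v 2 + k) with h7 | h7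
  · have hf : G.farCard v 2 = 0 := by omega
    have hV : Fintype.card V = 4 := by omega
    rw [hf] at h4
    rw [hV] at hN
    omega
  · rw [hN] at h6
    nlinarith

end Layers

section Retraction

variable {S : Set V} {c : V}

/-- The map onto `S` collapsing the complement of `S` to the vertex `c`. -/
noncomputable def collapse (hc : c ∈ S) (x : V) : S :=
  open Classical in if h : x ∈ S then ⟨x, h⟩ else ⟨c, hc⟩

lemma collapse_coe (hc : c ∈ S) (x : S) : collapse hc (x : V) = x := by
  simp [collapse]

lemma collapse_of_notMem (hc : c ∈ S) {x : V} (hx : x ∉ S) : collapse hc x = ⟨c, hc⟩ := by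
  simp [collapse, hx]

lemma mem_of_adj_of_collapse_ne (hc : c ∈ S)
    (hS : ∀ x ∈ S, ∀ y ∉ S, G.Adj x y → x = c) {x y : V} (h : G.Adj x y)
    (hne : collapse hc x ≠ collapse hc y) : x ∈ S ∧ y ∈ S := by
  by_contra hcon
  apply hne
  by_cases hx : x ∈ S
  · have hy : y ∉ S := fun hy => hcon ⟨hx, hy⟩
    obtain rfl := hS x hx y hy h
    rw [collapse_of_notMem hc hy, collapse_coe hc ⟨x, hx⟩]
  · rw [collapse_of_notMem hc hx]
    by_cases hy : y ∈ S
    · obtain rfl := hS y hy x hx h.symm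
      rw [collapse_coe hc ⟨y, hy⟩]
    · rw [collapse_of_notMem hc hy]

lemma exists_walk_collapse (hc : c ∈ S)
    (hS : ∀ x ∈ S, ∀ y ∉ S, G.Adj x y → x = c) {x y : V} (p : G.Walk x y) :
    ∃ q : (G.induce S).Walk (collapse hc x) (collapse hc y), q.length ≤ p.length := by
  induction p with
  | nil => exact ⟨.nil, by simp⟩
  | @cons x z y h p ih =>
    obtain ⟨q, hq⟩ := ih
    by_cases heq : collapse hc x = collapse hc z
    · rw [heq]
      exact ⟨q, by simp; omega⟩
    · obtain ⟨hx, hz⟩ := mem_of_adj_of_collapse_ne hc hS h heq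
      have hadj : (G.induce S).Adj (collapse hc x) (collapse hc z) := by
        rw [collapse_coe hc ⟨x, hx⟩, collapse_coe hc ⟨z, hz⟩]
        exact h
      exact ⟨.cons hadj q, by simpa using hq⟩

lemma Connected.induce_of_eq_of_adj (hG : G.Connected) (hc : c ∈ S)
    (hS : ∀ x ∈ S, ∀ y ∉ S, G.Adj x y → x = c) : (G.induce S).Connected := by
  have : Nonempty S := ⟨⟨c, hc⟩⟩
  refine ⟨fun x y => ?_⟩
  obtain ⟨p⟩ := hG.preconnected (x : V) y
  obtain ⟨q, -⟩ := exists_walk_collapse hc hS p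
  rw [collapse_coe, collapse_coe] at q
  exact ⟨q⟩

lemma Connected.dist_induce (hG : G.Connected) (hc : c ∈ S)
    (hS : ∀ x ∈ S, ∀ y ∉ S, G.Adj x y → x = c) (x y : S) :
    (G.induce S).dist x y = G.dist (x : V) y := by
  apply le_antisymm
  · obtain ⟨p, hp⟩ := hG.exists_walk_length_eq_dist (x : V) y
    obtain ⟨q, hq⟩ := exists_walk_collapse hc hS p
    rw [← hp]
    refine le_trans ?_ hq
    simpa only [collapse_coe] using dist_le q
  · obtain ⟨p, hp⟩ := (hG.induce_of_eq_of_adj hc hS).exists_walk_length_eq_dist x y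
    rw [← hp]
    exact (dist_le (p.map (Embedding.induce S).toHom)).trans_eq (p.length_map _)

lemma IsBridgeless.induce_of_eq_of_adj (hb : G.IsBridgeless) (hc : c ∈ S)
    (hS : ∀ x ∈ S, ∀ y ∉ S, G.Adj x y → x = c) : (G.induce S).IsBridgeless := by
  intro T x hx y hy hxy
  obtain ⟨x', hx', y', hy', hadj, hne⟩ := hb (collapse hc ⁻¹' T) x (by simpa [collapse_coe] using hx)
    y (by simpa [collapse_coe] using hy) hxy
  simp only [Set.mem_preimage] at hx' hy'
  obtain ⟨hxS, hyS⟩ := mem_of_adj_of_collapse_ne hc hS hadj (by rintro h; exact hy' (h ▸ hx'))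
  rw [collapse_coe hc ⟨x', hxS⟩] at hx'
  rw [collapse_coe hc ⟨y', hyS⟩] at hy'
  refine ⟨_, hx', _, hy', hadj, ?_⟩
  rintro rfl rfl
  exact hne rfl rfl

end Retraction

section Transmission

variable [Fintype V]

/-- The sum of the distances over all ordered pairs of vertices. -/
noncomputable def distSum (G : SimpleGraph V) : ℕ := ∑ x, ∑ y, G.dist x y

lemma Connected.distSum_le_of_isCut (hG : G.Connected) {c : V} {A S T : Finset V}
    [DecidableEq V] (hA : c ∉ A) (hS : S = insert c A) (hT : T = Aᶜ) :
    G.distSum + 2 * (∑ x ∈ S, G.dist x c + ∑ x ∈ T, G.dist x c) ≤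
      ∑ x ∈ S, ∑ y ∈ S, G.dist x y + ∑ x ∈ T, ∑ y ∈ T, G.dist x y +
        2 * (#T * ∑ x ∈ S, G.dist x c + #S * ∑ x ∈ T, G.dist x c) := by
  have key : ∀ f : V → ℕ, ∑ x, f x + f c = ∑ x ∈ S, f x + ∑ x ∈ T, f x := fun f => by
    rw [hS, hT, sum_insert hA, ← sum_add_sum_compl A f]
    ring
  have cross : ∀ P Q : Finset V, ∑ x ∈ P, ∑ y ∈ Q, G.dist x y ≤
      #Q * ∑ x ∈ P, G.dist x c + #P * ∑ x ∈ Q, G.dist x c := fun P Q => by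
    calc ∑ x ∈ P, ∑ y ∈ Q, G.dist x y
        ≤ ∑ x ∈ P, ∑ y ∈ Q, (G.dist x c + G.dist y c) :=
          sum_le_sum fun x _ => sum_le_sum fun y _ => by
            rw [dist_comm (u := y)]
            exact hG.dist_triangle
      _ = _ := by simp [sum_add_distrib, mul_sum]
  have h1 := key fun x => ∑ y, G.dist x y
  have h2 := key fun y => G.dist c y
  have h3 : ∑ x ∈ S, ∑ y, G.dist x y + ∑ x ∈ S, G.dist x c =
      ∑ x ∈ S, ∑ y ∈ S, G.dist x y + ∑ x ∈ S, ∑ y ∈ T, G.dist x y := by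
    simp only [← sum_add_distrib, ← key]
  have h4 : ∑ x ∈ T, ∑ y, G.dist x y + ∑ x ∈ T, G.dist x c =
      ∑ x ∈ T, ∑ y ∈ S, G.dist x y + ∑ x ∈ T, ∑ y ∈ T, G.dist x y := by
    simp only [← sum_add_distrib, ← key]
  have h5 := cross S T
  have h6 := cross T S
  simp only [dist_comm (u := c), dist_self, add_zero] at h2
  simp only [dist_comm (u := c)] at h1
  rw [distSum]
  linarith

lemma Connected.card_le_sum_dist_add_one (hG : G.Connected) (v : V) :
    Fintype.card V ≤ ∑ u, G.dist v u + 1 := by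
  classical
  have h1 : ∑ _u : V, 1 ≤ ∑ u, (G.dist v u + if u = v then 1 else 0) := by
    refine sum_le_sum fun u _ => ?_
    split_ifs with h
    · omega
    · have := hG.pos_dist_of_ne (Ne.symm h)
      omega
  simpa [sum_add_distrib] using h1

end Transmission

lemma lt_mul_sq_div_four_of_cut {a b n T T₁ T₂ D₁ D₂ : ℕ} (ha : 2 ≤ a) (hb : 2 ≤ b)
    (hn : n + 1 = a + b) (h₁ : 4 * T₁ ≤ a ^ 3) (h₂ : 4 * T₂ ≤ b ^ 3)
    (hD₁ : 3 * D₁ + a ≤ a ^ 2) (hD₂ : 3 * D₂ + b ≤ b ^ 2) (hl₁ : a ≤ D₁ + 1) (hl₂ : b ≤ D₂ + 1)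
    (hT : T + 2 * (D₁ + D₂) ≤ T₁ + T₂ + 2 * (b * D₁ + a * D₂)) :
    T < n * (n ^ 2 / 4) := by
  have ha3 : 3 ≤ a := by
    by_contra!
    obtain rfl : a = 2 := by omega
    omega
  have hb3 : 3 ≤ b := by
    by_contra!
    obtain rfl : b = 2 := by omega
    omega
  obtain ⟨p, rfl⟩ := Nat.exists_eq_add_of_le ha3
  obtain ⟨q, rfl⟩ := Nat.exists_eq_add_of_le hb3
  obtain rfl : n = p + q + 5 := by omega
  have hdiv : (p + q + 5) ^ 2 ≤ 4 * ((p + q + 5) ^ 2 / 4) + 1 := by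
    rcases Nat.even_or_odd' (p + q + 5) with ⟨k, hk | hk⟩
    · have : (p + q + 5) ^ 2 = 4 * k ^ 2 := by rw [hk]; ring
      omega
    · have : (p + q + 5) ^ 2 = 4 * (k ^ 2 + k) + 1 := by rw [hk]; ring
      omega
  have hm := Nat.mul_le_mul_left (p + q + 5) hdiv
  have e1 : 3 * ((2 + q) * D₁) ≤ (2 + q) * ((3 + p) * (2 + p)) := by
    have : 3 * D₁ ≤ (3 + p) * (2 + p) := by nlinarith
    nlinarith
  have e2 : 3 * ((2 + p) * D₂) ≤ (2 + p) * ((3 + q) * (2 + q)) := by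
    have : 3 * D₂ ≤ (3 + q) * (2 + q) := by nlinarith
    nlinarith
  have e3 : T ≤ T₁ + T₂ + 2 * ((2 + q) * D₁ + (2 + p) * D₂) := by nlinarith
  generalize (p + q + 5) ^ 2 / 4 = m at *
  have e4 : 12 * T ≤ 3 * (3 + p) ^ 3 + 3 * (3 + q) ^ 3 + 8 * ((2 + q) * ((3 + p) * (2 + p))) +
    8 * ((2 + p) * ((3 + q) * (2 + q))) := by linarith
  have e5 : 3 * (3 + p) ^ 3 + 3 * (3 + q) ^ 3 + 8 * ((2 + q) * ((3 + p) * (2 + p))) +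
    8 * ((2 + p) * ((3 + q) * (2 + q))) + 3 * (p + q + 5) < 3 * (p + q + 5) ^ 3 := by
    have : 0 ≤ p * q * (p + q) := Nat.zero_le _
    have : 0 ≤ p * q := Nat.zero_le _
    nlinarith
  nlinarith

lemma four_mul_le_cube {n T : ℕ} (h : T ≤ n * (n ^ 2 / 4)) : 4 * T ≤ n ^ 3 := by
  have := Nat.mul_div_le (n ^ 2) 4
  nlinarith

theorem Connected.distSum_le {V : Type*} [Fintype V] {G : SimpleGraph V} (hG : G.Connected)
    (hb : G.IsBridgeless) :
    G.distSum ≤ Fintype.card V * (Fintype.card V ^ 2 / 4) ∧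
      (3 ≤ Fintype.card V → G.distSum = Fintype.card V * (Fintype.card V ^ 2 / 4) →
        ∀ v, (G.neighborSet v).ncard = 2) := by
  classical
  induction hn : Fintype.card V using Nat.strong_induction_on generalizing V with
  | _ n ih =>
  by_cases hcut : ∀ c A, ¬ G.IsCut c A
  · have hle : ∀ v ∈ univ, ∑ u, G.dist v u ≤ n ^ 2 / 4 := fun v _ => by
      have := hG.four_mul_sum_dist_le hcut v
      rw [hn] at this
      omega
    have hsum : n * (n ^ 2 / 4) = ∑ _v : V, n ^ 2 / 4 := by simp [hn]
    rw [hsum]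
    refine ⟨sum_le_sum hle, fun h3 heq v => ?_⟩
    refine hG.ncard_neighborSet_eq_two hcut (hn ▸ h3) v ?_
    rw [hn]
    exact (sum_eq_sum_iff_of_le hle).1 heq v (mem_univ v)
  · push Not at hcut
    obtain ⟨c, A, hA⟩ := hcut
    obtain ⟨S, hS⟩ : ∃ S : Finset V, S = insert c A := ⟨_, rfl⟩
    obtain ⟨T, hT⟩ : ∃ T : Finset V, T = Aᶜ := ⟨_, rfl⟩
    have part : ∀ P : Finset V, c ∈ P → (∀ x ∈ P, ∀ y ∉ P, G.Adj x y → x = c) → #P < n →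
        4 * ∑ x ∈ P, ∑ y ∈ P, G.dist x y ≤ #P ^ 3 ∧
        3 * ∑ x ∈ P, G.dist x c + #P ≤ #P ^ 2 ∧ #P ≤ ∑ x ∈ P, G.dist x c + 1 := by
      intro P hcP hP hlt
      have hcP' : c ∈ (P : Set V) := hcP
      have hP' : ∀ x ∈ (P : Set V), ∀ y ∉ (P : Set V), G.Adj x y → x = c := hP
      have hcon := hG.induce_of_eq_of_adj hcP' hP'
      have hbr := hb.induce_of_eq_of_adj hcP' hP'
      have hsub : ∀ f : V → ℕ, ∑ x ∈ P, f x = ∑ x : (P : Set V), f x :=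
        sum_subtype P (fun _ => Iff.rfl)
      have hcard : Fintype.card (P : Set V) = #P := by simp
      have h1 := (ih _ hlt hcon hbr hcard).1
      have h2 := hcon.three_mul_sum_dist_le hbr ⟨c, hcP⟩
      have h3 := hcon.card_le_sum_dist_add_one ⟨c, hcP⟩
      simp only [distSum, hG.dist_induce hcP' hP', hcard, dist_comm (u := c)] at h1 h2 h3
      simp only [hsub]
      exact ⟨four_mul_le_cube h1, h2, h3⟩
    have hcardS : #S = #A + 1 := by rw [hS, card_insert_of_notMem hA.notMem]
    have hcardT : #T + #A = n := by rw [hT, card_compl, hn]; have := card_le_univ A; omega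
    have hApos := hA.nonempty.card_pos
    have hT2 : 2 ≤ #T := by
      obtain ⟨b, hbA, hbc⟩ := hA.exists_other
      exact one_lt_card.2 ⟨b, by simp [hT, hbA], c, by simp [hT, hA.notMem], hbc⟩
    obtain ⟨s1, s2, s3⟩ := part S (by simp [hS]) (by
      intro x hx y hy hxy
      simp only [hS, mem_insert, not_or] at hx hy
      exact hx.resolve_right fun hxA => hy.1 (hA.eq_of_adj x hxA y hy.2 hxy)) (by omega)
    obtain ⟨t1, t2, t3⟩ := part T (by simp [hT, hA.notMem]) (by
      intro x hx y hy hxy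
      simp only [hT, mem_compl, not_not] at hx hy
      exact hA.eq_of_adj y hy x hx hxy.symm) (by omega)
    have hlt := lt_mul_sq_div_four_of_cut (n := n) (by omega) hT2 (by omega) s1 t1 s2 t2 s3 t3
      (hG.distSum_le_of_isCut hA.notMem hS hT)
    exact ⟨hlt.le, fun _ h => absurd h hlt.ne⟩

lemma isBridgeless_of_even_degree [Fintype V] [DecidableRel G.Adj] (h : ∀ v, Even (G.degree v)) :
    G.IsBridgeless := by
  classical
  intro S x hx y hy hxy
  by_contra! hcon
  have hcross : {z ∈ G.neighborFinset x | z ∉ S} = {y} := by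
    ext z
    simp only [mem_filter, mem_neighborFinset, mem_singleton]
    exact ⟨fun hz => (hcon x hx z hz.2 hz.1).2, by rintro rfl; exact ⟨hxy, hy⟩⟩
  have hdeg : ∀ u : S, G.degree u = (G.induce S).degree u + if (u : V) = x then 1 else 0 := by
    intro u
    have h1 : (G.induce S).degree u = #{z ∈ G.neighborFinset u | z ∈ S} := by
      rw [← card_neighborFinset_eq_degree, ← card_map (Function.Embedding.subtype (· ∈ S))]
      congr 1
      ext z
      simp
    have h2 : #{z ∈ G.neighborFinset (u : V) | z ∉ S} = if (u : V) = x then 1 else 0 := by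
      split_ifs with hu
      · rw [hu, hcross, card_singleton]
      · rw [card_eq_zero, filter_eq_empty_iff]
        intro z hz hzS
        exact hu (hcon u u.2 z hzS (by simpa using hz)).1
    rw [h1, ← h2, ← card_neighborFinset_eq_degree, card_filter_add_card_filter_not]
  have hs : ∑ u : S, G.degree u = 2 * #(G.induce S).edgeFinset + 1 := by
    rw [← sum_degrees_eq_twice_card_edges, sum_congr rfl fun u _ => hdeg u, sum_add_distrib]
    congr 1
    rw [sum_eq_single ⟨x, hx⟩] <;> simp +contextual [Subtype.ext_iff]
  have he : Even (∑ u : S, G.degree (u : V)) := by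
    exact Finset.even_sum (fun u : S => G.degree (u : V)) fun u _ => h u
  rw [hs] at he
  grind

lemma Connected.nonempty_iso_cycleGraph {n : ℕ} {G : SimpleGraph (Fin n)} (hG : G.Connected)
    (hn : 3 ≤ n) (h : ∀ v, (G.neighborSet v).ncard = 2) : Nonempty (G ≃g cycleGraph n) := by
  classical
  have hcyc : G.IsCycles := fun v _ => h v
  let v : Fin n := ⟨0, by omega⟩
  obtain ⟨p, hp, hverts⟩ := hcyc.exists_cycle_toSubgraph_verts_eq_connectedComponentSupp
    (c := G.connectedComponentMk v) (v := v) rfl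
    (Set.nonempty_of_ncard_ne_zero (by rw [h]; omega))
  have hall : ∀ w, w ∈ p.support := fun w => by
    rw [← Walk.mem_verts_toSubgraph, hverts]
    exact ConnectedComponent.sound (hG.preconnected w v)
  have hham : p.IsHamiltonianCycle := by
    rw [Walk.isHamiltonianCycle_iff_isCycle_and_support_count_tail_eq_one]
    refine ⟨hp, fun w => List.count_eq_one_of_mem hp.support_nodup ?_⟩
    rcases p.mem_support_iff.1 (hall w) with rfl | hw
    · exact Walk.end_mem_tail_support hp.not_nil
    · exact hw
  have hlen : p.length = n := by simpa using hham.length_eq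
  obtain ⟨f⟩ := (cycleGraph_isContained_iff hn).2 ⟨v, p, hp, hlen⟩
  let e : Fin n ≃ Fin n := Equiv.ofBijective f (Finite.injective_iff_bijective.1 f.injective)
  refine ⟨(RelIso.symm ⟨e, ?_⟩ : G ≃g cycleGraph n)⟩
  intro a b
  refine ⟨fun hab => ?_, fun hab => f.toHom.map_adj hab⟩
  have himg : f '' (cycleGraph n).neighborSet a = G.neighborSet (f a) := by
    apply Set.eq_of_subset_of_ncard_le
    · rintro _ ⟨z, hz, rfl⟩
      exact f.toHom.map_adj hz
    · rw [h, show (f '' (cycleGraph n).neighborSet a).ncard = _ from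
        Set.ncard_image_of_injective _ f.injective]
      obtain ⟨m, rfl⟩ := Nat.exists_eq_add_of_le' hn
      rw [← coe_neighborFinset, Set.ncard_coe_finset, card_neighborFinset_eq_degree,
        cycleGraph_degree_three_le]
    · exact Set.toFinite _
  have hb : f b ∈ G.neighborSet (f a) := hab
  rw [← himg] at hb
  obtain ⟨z, hz, hzb⟩ := hb
  rwa [f.injective hzb] at hz

lemma min_le_dist_cycleGraph {n : ℕ} (x y : Fin (n + 2)) :
    min (x - y).val (n + 2 - (x - y).val) ≤ (cycleGraph (n + 2)).dist x y := by
  obtain ⟨p, hp⟩ := cycleGraph_connected.exists_walk_length_eq_dist x y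
  rw [← hp]
  clear hp
  induction p with
  | nil => simp
  | @cons x z y h p ih =>
    rw [Walk.length_cons]
    have hstep : ∀ t : Fin (n + 2), (t + 1).val = if t.val = n + 1 then 0 else t.val + 1 := by
      intro t
      rw [Fin.val_add_one]
      simp [Fin.ext_iff]
    rcases cycleGraph_adj.1 h with h | h
    · have e : x - y = (z - y) + 1 := by rw [← h]; abel
      have := hstep (z - y)
      rw [e]
      have := (z - y).isLt
      split_ifs at * <;> omega
    · have e : z - y = (x - y) + 1 := by rw [← h]; abel
      rw [e] at ih
      have := hstep (x - y)
      have := (x - y).isLt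
      split_ifs at * <;> omega

lemma le_distSum_cycleGraph (n : ℕ) :
    (n + 2) * ((n + 2) ^ 2 / 4) ≤ (cycleGraph (n + 2)).distSum := by
  rw [distSum, sum_comm]
  calc (n + 2) * ((n + 2) ^ 2 / 4) = ∑ _y : Fin (n + 2), (n + 2) ^ 2 / 4 := by simp
    _ ≤ _ := sum_le_sum fun y _ => ?_
  rw [← sum_min_range, ← Fin.sum_univ_eq_sum_range (fun k => min k (n + 2 - k)),
    ← Equiv.sum_comp (Equiv.subRight y)]
  exact sum_le_sum fun x _ => min_le_dist_cycleGraph x y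

lemma Iso.dist_le_dist {W : Type*} {H : SimpleGraph W} (e : G ≃g H) (hG : G.Connected) (x y : V) :
    H.dist (e x) (e y) ≤ G.dist x y := by
  obtain ⟨p, hp⟩ := hG.exists_walk_length_eq_dist x y
  rw [← hp]
  simpa using dist_le (p.map e.toHom)

lemma Iso.distSum_le {W : Type*} [Fintype V] [Fintype W] {H : SimpleGraph W} (e : G ≃g H)
    (hG : G.Connected) : H.distSum ≤ G.distSum := by
  rw [distSum, distSum, ← Equiv.sum_comp e.toEquiv]
  refine sum_le_sum fun x _ => ?_
  rw [← Equiv.sum_comp e.toEquiv]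
  exact sum_le_sum fun y _ => e.dist_le_dist hG x y

lemma two_mul_wienerIndex {n : ℕ} (G : SimpleGraph (Fin n)) :
    2 * wienerIndex G = G.distSum := by
  have hswap : ∑ p : Fin n × Fin n with p.2 < p.1, G.dist p.1 p.2 = wienerIndex G := by
    rw [wienerIndex]
    refine sum_equiv (Equiv.prodComm _ _) (by simp) fun p _ => ?_
    simp [dist_comm]
  rw [two_mul, distSum, ← Fintype.sum_prod_type' (f := fun x y => G.dist x y)]
  nth_rw 1 [← hswap]
  rw [wienerIndex, sum_filter, sum_filter, ← sum_add_distrib]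
  refine sum_congr rfl fun p _ => ?_
  rcases lt_trichotomy p.1 p.2 with h | h | h
  · simp [h, h.not_gt]
  · simp [h]
  · simp [h, h.not_gt]

end SimpleGraph

/-- For every Eulerian graph `G` of order `n`, `W(G) ≤ W(C_n)`,
with equality if and only if `G ≅ C_n`. -/
theorem wiener_le_of_eulerian {n : ℕ} (G : SimpleGraph (Fin n))
    [DecidableRel G.Adj] (h : IsEulerian G) :
    wienerIndex G ≤ wienerIndex (cycleGraph n) ∧
      (wienerIndex G = wienerIndex (cycleGraph n) ↔
        Nonempty (G ≃g cycleGraph n)) := by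
  obtain ⟨hG, heven⟩ := h
  have hpos : 0 < n := Fin.pos_iff_nonempty.2 hG.nonempty
  obtain rfl | hn := Nat.eq_or_lt_of_le (Nat.succ_le_of_lt hpos)
  · have hGe : G = cycleGraph 1 := Subsingleton.elim _ _
    rw [hGe]
    exact ⟨le_rfl, fun _ => ⟨Iso.refl⟩, fun _ => rfl⟩
  have hb := isBridgeless_of_even_degree heven
  have hW := two_mul_wienerIndex G
  have hC := two_mul_wienerIndex (cycleGraph n)
  have hcard : Fintype.card (Fin n) = n := Fintype.card_fin n
  have hn3 : 3 ≤ n := by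
    have h1 := hG.three_mul_sum_dist_le hb ⟨0, hpos⟩
    have h2 := hG.card_le_sum_dist_add_one ⟨0, hpos⟩
    rw [hcard] at h1 h2
    by_contra! hlt
    obtain rfl : n = 2 := by omega
    omega
  obtain ⟨hle, heq⟩ := hG.distSum_le hb
  have hcyc : n * (n ^ 2 / 4) ≤ (cycleGraph n).distSum := by
    obtain ⟨m, rfl⟩ := Nat.exists_eq_add_of_le' (show 2 ≤ n from hn)
    exact le_distSum_cycleGraph m
  rw [hcard] at hle heq
  refine ⟨by omega, fun h => hG.nonempty_iso_cycleGraph hn3 (heq hn3 (by omega)), fun ⟨e⟩ => ?_⟩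
  have := e.distSum_le hG
  omega
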